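/- (Local structure at a degenerate zero) Let K : ℝ² → ℝ be a smooth (C^∞) function and let φ : ℝ² → ℝ be a C² function, not identically zero, satisfying Δφ(y) + K(y) φ(y) = 0 on ℝ², φ(0) = 0, and ∇φ(0) = 0. Then there exist an integer m ≥ 2 and a nonzero homogeneous harmonic polynomial Q of degree m on ℝ² such that φ(y) = Q(y) + o(|y|^m) as y → 0. -/

import Mathlib

open MeasureTheory Real Asymptotics Filter

/-- The Euclidean Laplacian on `ℝ²`: the sum of the two pure second partial
derivatives in the standard coordinate directions. -/
noncomputable def planeLaplacian (v : EuclideanSpace ℝ (Fin 2) → ℝ)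
    (y : EuclideanSpace ℝ (Fin 2)) : ℝ :=
  ∑ i : Fin 2,
    fderiv ℝ (fun z => fderiv ℝ v z (EuclideanSpace.single i 1)) y
      (EuclideanSpace.single i 1)


namespace HW
open Complex Set Topology

lemma K1 (G : ℂ → ℂ) (z : ℂ) :
    ∫ ζ, G ζ / (ζ - z) = ∫ p in Ioi (0:ℝ) ×ˢ Ioo (-π) π,
      Complex.exp (-(p.2 * I)) * G (z + p.1 * Complex.exp (p.2 * I)) := by
  rw [← integral_add_left_eq_self (μ := volume) (fun ζ => G ζ / (ζ - z)) z,
    ← Complex.integral_comp_polarCoord_symm]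
  refine setIntegral_congr_fun (measurableSet_Ioi.prod measurableSet_Ioo) ?_
  rintro ⟨r, t⟩ ⟨hr, ht⟩
  have hr' : (r:ℂ) ≠ 0 := by
    have : (0:ℝ) < r := hr
    exact_mod_cast this.ne'
  have he : ((Real.cos t : ℂ) + Real.sin t * I) = Complex.exp (t * I) := by
    rw [Complex.exp_mul_I]; simp
  simp only [Complex.polarCoord_symm_apply, add_sub_cancel_left, Complex.real_smul]
  rw [he, Complex.exp_neg]
  have := Complex.exp_ne_zero (t * I)
  field_simp

lemma K2 (G : ℂ → ℂ) (z : ℂ) (R : ℝ) (hG : ∀ ζ, R < ‖ζ‖ → G ζ = 0) (L : ℝ) (hL : R + ‖z‖ ≤ L) :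
    ∫ ζ, G ζ / (ζ - z) = ∫ p in Ioc (0:ℝ) L ×ˢ Ioc (-π) π,
      Complex.exp (-(p.2 * I)) * G (z + p.1 * Complex.exp (p.2 * I)) := by
  rw [K1]
  have h1 : (Ioi (0:ℝ) ×ˢ Ioo (-π) π) =ᵐ[volume] (Ioi (0:ℝ) ×ˢ Ioc (-π) π) :=
    Measure.set_prod_ae_eq (ae_eq_refl _) Ioo_ae_eq_Ioc
  rw [setIntegral_congr_set h1]
  refine setIntegral_eq_of_subset_of_forall_sdiff_eq_zero
    (measurableSet_Ioi.prod measurableSet_Ioc) ?_ ?_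
  · exact Set.prod_mono Ioc_subset_Ioi_self Subset.rfl
  · rintro ⟨r, t⟩ ⟨⟨hr, ht⟩, h⟩
    simp only [mem_prod, mem_Ioc, mem_Ioi] at hr ht h
    have hrL : L < r := by
      by_contra hc
      exact h ⟨⟨hr, not_lt.1 hc⟩, ht⟩
    simp only
    rw [hG, mul_zero]
    have h2 : ‖(r:ℂ) * Complex.exp (t * I)‖ = r := by
      rw [norm_mul, Complex.norm_exp_ofReal_mul_I, mul_one, Complex.norm_real, Real.norm_of_nonneg hr.le]
    have := norm_sub_le (z + r * Complex.exp (t * I)) z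
    rw [add_sub_cancel_left, h2] at this
    linarith

lemma K_bound (G : ℂ → ℂ) (z : ℂ) (R M : ℝ) (hR : 0 ≤ R) (hG : ∀ ζ, R < ‖ζ‖ → G ζ = 0)
    (hM : ∀ ζ, ‖G ζ‖ ≤ M) :
    ‖∫ ζ, G ζ / (ζ - z)‖ ≤ M * (2 * π * (R + ‖z‖)) := by
  rw [K2 G z R hG _ le_rfl]
  have hv : (volume : Measure (ℝ × ℝ)) (Ioc (0:ℝ) (R + ‖z‖) ×ˢ Ioc (-π) π)
      = ENNReal.ofReal (2 * π * (R + ‖z‖)) := by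
    have hz := norm_nonneg z
    rw [Measure.volume_eq_prod, Measure.prod_prod, Real.volume_Ioc, Real.volume_Ioc,
      ← ENNReal.ofReal_mul (by linarith)]
    congr 1; ring
  have := norm_setIntegral_le_of_norm_le_const (μ := (volume : Measure (ℝ × ℝ)))
    (s := Ioc (0:ℝ) (R + ‖z‖) ×ˢ Ioc (-π) π)
    (f := fun p => Complex.exp (-(p.2 * I)) * G (z + p.1 * Complex.exp (p.2 * I))) (C := M)
    (by rw [hv]; exact ENNReal.ofReal_lt_top) (by
      rintro ⟨r, t⟩ _
      have : ‖Complex.exp (-(t * I))‖ = 1 := by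
        rw [← neg_mul, ← Complex.ofReal_neg, Complex.norm_exp_ofReal_mul_I]
      rw [norm_mul, this, one_mul]; exact hM _)
  rwa [Measure.real, hv, ENNReal.toReal_ofReal (by positivity)] at this

lemma K_int (G : ℂ → ℂ) (hm : Measurable G) (z : ℂ) (R M : ℝ) (hG : ∀ ζ, R < ‖ζ‖ → G ζ = 0)
    (hM : ∀ ζ, ‖G ζ‖ ≤ M) : Integrable (fun ζ => G ζ / (ζ - z)) := by
  have hM0 : 0 ≤ M := (norm_nonneg _).trans (hM 0)
  refine ⟨(by fun_prop : Measurable _).aestronglyMeasurable, ?_⟩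
  unfold HasFiniteIntegral
  rw [← lintegral_add_left_eq_self (μ := volume) (fun ζ => ‖G ζ / (ζ - z)‖ₑ) z,
    ← Complex.lintegral_comp_polarCoord_symm]
  set L := R + ‖z‖
  calc _ ≤ ∫⁻ p in polarCoord.target,
      (Iic L ×ˢ univ).indicator (fun _ : ℝ × ℝ => ENNReal.ofReal M) p := by
        refine setLIntegral_mono' polarCoord.open_target.measurableSet ?_
        rintro ⟨r, t⟩ ⟨hr, ht⟩
        have hr' : (0:ℝ) < r := hr
        have he : ((Real.cos t : ℂ) + Real.sin t * I) = Complex.exp (t * I) := by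
          rw [Complex.exp_mul_I]; simp
        simp only [Complex.polarCoord_symm_apply, add_sub_cancel_left, smul_eq_mul]
        rw [he]
        have h2 : ‖(r:ℂ) * Complex.exp (t * I)‖ = r := by
          rw [norm_mul, Complex.norm_exp_ofReal_mul_I, mul_one, Complex.norm_real, Real.norm_of_nonneg hr'.le]
        by_cases hrL : r ≤ L
        · rw [indicator_of_mem (by simp [hrL]), ← ofReal_norm, ← ENNReal.ofReal_mul hr'.le,
            norm_div, h2, mul_div_cancel₀ _ hr'.ne']
          exact ENNReal.ofReal_le_ofReal (hM _)
        · rw [hG]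
          · simp
          have := norm_sub_le (z + r * Complex.exp (t * I)) z
          rw [add_sub_cancel_left, h2] at this
          simp only [L] at hrL
          linarith
    _ < ⊤ := by
        rw [lintegral_indicator (measurableSet_Iic.prod MeasurableSet.univ), setLIntegral_const,
          Measure.restrict_apply (measurableSet_Iic.prod MeasurableSet.univ)]
        refine ENNReal.mul_lt_top ENNReal.ofReal_lt_top ?_
        have : (Iic L ×ˢ univ ∩ polarCoord.target) ⊆ Icc (0:ℝ) L ×ˢ Icc (-π) π := by
          rintro ⟨r, t⟩ ⟨⟨h1, _⟩, h2, h3⟩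
          exact ⟨⟨le_of_lt h2, h1⟩, ⟨h3.1.le, h3.2.le⟩⟩
        exact (measure_mono this).trans_lt (isCompact_Icc.prod isCompact_Icc).measure_lt_top

lemma CP (F G : ℂ → ℂ) (hc : Continuous F) (hm : Measurable G) (R M : ℝ)
    (hR : 0 ≤ R) (hF : ∀ ζ, R < ‖ζ‖ → F ζ = 0)
    (hG : ∀ ζ, R < ‖ζ‖ → G ζ = 0) (hM : ∀ ζ, ‖G ζ‖ ≤ M)
    (hd : ∀ ζ, ζ ≠ 0 → ∃ F' : ℂ →L[ℝ] ℂ, HasFDerivAt F F' ζ ∧ F' 1 + I * F' I = 2 * G ζ) (z : ℂ) :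
    ∫ ζ, G ζ / (ζ - z) = - π * F z := by
  choose! F' hF' hFG using hd
  set L := R + ‖z‖ + 1 with hL
  have hL0 : 0 < L := by positivity
  set P : ℝ × ℝ → ℂ := fun p => z + p.1 * Complex.exp (p.2 * I) with hP
  set J : ℝ × ℝ → ℂ := fun p => Complex.exp (-(p.2 * I)) * G (P p) with hJ
  have hPc : Continuous P := by fun_prop
  have hJm : Measurable J := by
    have : Measurable P := hPc.measurable
    have h2 : Continuous (fun p : ℝ × ℝ => Complex.exp (-(p.2 * I))) := by fun_prop
    exact h2.measurable.mul (hm.comp this)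
  have hJM : ∀ p, ‖J p‖ ≤ M := by
    rintro ⟨r, t⟩
    have : ‖Complex.exp (-(t * I))‖ = 1 := by
      rw [← neg_mul, ← Complex.ofReal_neg, Complex.norm_exp_ofReal_mul_I]
    simp only [hJ]
    rw [norm_mul, this, one_mul]; exact hM _
  have hJi : ∀ a b : ℝ, IntegrableOn J (Icc a b ×ˢ Icc (-π) π) := fun a b =>
    Measure.integrableOn_of_bounded (M := M) (isCompact_Icc.prod isCompact_Icc).measure_lt_top.ne
      hJm.aestronglyMeasurable (Eventually.of_forall hJM)
  set j : ℝ → ℂ := fun r => ∫ t in (-π)..π, J (r, t) with hj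
  have hjM : ∀ r, ‖j r‖ ≤ M * (2 * π) := fun r => by
    have := intervalIntegral.norm_integral_le_of_norm_le_const (a := -π) (b := π)
      (f := fun t => J (r, t)) (C := M) (fun t _ => hJM _)
    rwa [show π - -π = 2 * π by ring, abs_of_pos (by positivity)] at this
  have hpi : -π ≤ π := by linarith [pi_pos]
  have key : ∀ ε ∈ Ioo 0 L, ∫ r in ε..L, 2 * j r = - ∫ t in (-π)..π, F (P (ε, t)) := by
    rintro ε ⟨hε, hεL⟩
    let P' : ℝ × ℝ → ℝ × ℝ →L[ℝ] ℂ := fun p =>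
      (ContinuousLinearMap.fst ℝ ℝ ℝ).smulRight (Complex.exp (p.2 * I)) +
      (ContinuousLinearMap.snd ℝ ℝ ℝ).smulRight (p.1 * (Complex.exp (p.2 * I) * I))
    have hPd : ∀ p, HasFDerivAt P (P' p) p := by
      rintro p
      have h1 : HasFDerivAt (fun p : ℝ × ℝ => (p.1 : ℂ))
          (Complex.ofRealCLM.comp (ContinuousLinearMap.fst ℝ ℝ ℝ)) p :=
        (Complex.ofRealCLM.comp (ContinuousLinearMap.fst ℝ ℝ ℝ)).hasFDerivAt
      have h2 : HasFDerivAt (fun p : ℝ × ℝ => (p.2 : ℂ))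
          (Complex.ofRealCLM.comp (ContinuousLinearMap.snd ℝ ℝ ℝ)) p :=
        (Complex.ofRealCLM.comp (ContinuousLinearMap.snd ℝ ℝ ℝ)).hasFDerivAt
      have h3 := (h1.mul ((h2.mul_const I).cexp)).const_add z
      refine h3.congr_fderiv ?_
      ext <;> simp [P']
    let s : Set (ℝ × ℝ) := {p | p ∈ Ioi (0:ℝ) ×ˢ Ioo (-π) π ∧ P p = 0}
    have hs : s.Countable := by
      refine Set.Subsingleton.countable ?_
      rintro p ⟨hp, hp0⟩ q ⟨hq, hq0⟩
      refine Complex.polarCoord.symm.injOn (by exact hp) (by exact hq) ?_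
      simp only [Complex.polarCoord_symm_apply]
      have he : ∀ t : ℝ, ((Real.cos t : ℂ) + Real.sin t * I) = Complex.exp (t * I) := by
        intro t
        rw [Complex.exp_mul_I]; simp
      rw [he, he]
      simp only [hP] at hp0 hq0
      linear_combination hp0 - hq0
    have hrec : ∀ x, x ∈ Ioo (min ε L) (max ε L) ×ˢ Ioo (min (-π) π) (max (-π) π) \ s →
        0 < x.1 ∧ P x ≠ 0 := by
      rintro ⟨r, t⟩ ⟨⟨h1, h2⟩, h3⟩
      rw [min_eq_left hεL.le] at h1
      rw [min_eq_left hpi, max_eq_right hpi] at h2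
      have h4 : 0 < r := hε.trans h1.1
      exact ⟨h4, fun h => h3 ⟨⟨h4, h2⟩, h⟩⟩
    let f' : ℝ × ℝ → ℝ × ℝ →L[ℝ] ℂ := fun p => (F' (P p)).comp (P' p)
    let g' : ℝ × ℝ → ℝ × ℝ →L[ℝ] ℂ := fun p =>
      (I * (p.1:ℂ)⁻¹) • (f' p) + F (P p) • ((ContinuousLinearMap.fst ℝ ℝ ℝ).smulRight (-I * ((p.1:ℂ)^2)⁻¹))
    have hsum : ∀ x : ℝ × ℝ, 0 < x.1 → P x ≠ 0 → f' x (1,0) + g' x (0,1) = 2 * J x := by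
      rintro ⟨r, t⟩ hr hx
      have hr' : (r:ℂ) ≠ 0 := by
        have : (0:ℝ) < r := hr
        exact_mod_cast this.ne'
      have hlin : ∀ v : ℂ, F' (P (r,t)) v = v.re * F' (P (r,t)) 1 + v.im * F' (P (r,t)) I := by
        intro v
        conv_lhs => rw [show v = v.re • (1:ℂ) + v.im • I by simp]
        rw [map_add, map_smul, map_smul]; simp
      have h1 := hFG _ hx
      simp only [f', g', P', hJ, ContinuousLinearMap.comp_apply, add_apply,
        smul_apply, ContinuousLinearMap.smulRight_apply,
        ContinuousLinearMap.coe_fst', ContinuousLinearMap.coe_snd', one_smul, zero_smul, add_zero, zero_add, smul_eq_mul]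
      rw [hlin (cexp (t * I)), hlin (r * _)]
      have e1 : cexp (t * I) = Real.cos t + Real.sin t * I := by rw [Complex.exp_mul_I]; simp
      have e2 : cexp (-(t * I)) = Real.cos t - Real.sin t * I := by
        rw [← neg_mul, Complex.exp_mul_I]; simp [sub_eq_add_neg]
      rw [e2, e1]
      have a1 : ((Real.cos t : ℂ) + Real.sin t * I).re = Real.cos t := by simp [-ofReal_cos, -ofReal_sin]
      have a2 : ((Real.cos t : ℂ) + Real.sin t * I).im = Real.sin t := by simp [-ofReal_cos, -ofReal_sin]
      have a3 : ((r:ℂ) * (((Real.cos t : ℂ) + Real.sin t * I) * I)).re = - (r * Real.sin t) := by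
        simp [-ofReal_cos, -ofReal_sin]
      have a4 : ((r:ℂ) * (((Real.cos t : ℂ) + Real.sin t * I) * I)).im = r * Real.cos t := by
        simp [-ofReal_cos, -ofReal_sin]
      rw [a1, a2, a3, a4]
      push_cast [-ofReal_cos, -ofReal_sin]
      set A := F' (P (r,t)) 1
      set B := F' (P (r,t)) I
      have h3 : 2 * ((Real.cos t - Real.sin t * I) * G (P (r,t)))
        = (Real.cos t - Real.sin t * I) * (A + I * B) := by rw [h1]; ring
      rw [h3]
      have hi : (r:ℂ)⁻¹ * r = 1 := inv_mul_cancel₀ hr'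
      linear_combination (I * (-Real.sin t * A + Real.cos t * B)) * hi + (Real.sin t * B) * I_sq
    have hpos : ∀ x ∈ uIcc ε L ×ˢ uIcc (-π) π, (x.1:ℂ) ≠ 0 := by
      rintro x ⟨h1, _⟩
      rw [uIcc_of_le hεL.le] at h1
      exact_mod_cast (hε.trans_le h1.1).ne'
    have := integral2_divergence_prod_of_hasFDerivAt_off_countable (fun p => F (P p))
      (fun p => I * (p.1:ℂ)⁻¹ * F (P p)) f' g' ε (-π) L π s hs
      (by fun_prop) (by
        refine ContinuousOn.mul (ContinuousOn.mul continuousOn_const ?_) (by fun_prop)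
        exact ContinuousOn.inv₀ (by fun_prop) hpos)
      (by
        intro x hx
        exact (hF' _ (hrec x hx).2).comp x (hPd x))
      (by
        intro x hx
        have hr' : (x.1:ℂ) ≠ 0 := by exact_mod_cast (hrec x hx).1.ne'
        have h1 : HasFDerivAt (fun p : ℝ × ℝ => (p.1 : ℂ))
            (Complex.ofRealCLM.comp (ContinuousLinearMap.fst ℝ ℝ ℝ)) x :=
          (Complex.ofRealCLM.comp (ContinuousLinearMap.fst ℝ ℝ ℝ)).hasFDerivAt
        have h2 : HasFDerivAt (fun p : ℝ × ℝ => I * (p.1:ℂ)⁻¹)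
            ((ContinuousLinearMap.fst ℝ ℝ ℝ).smulRight (-I * ((x.1:ℂ)^2)⁻¹)) x := by
          have := ((hasDerivAt_inv hr').hasFDerivAt.restrictScalars ℝ).comp x h1
          refine (this.const_mul I).congr_fderiv ?_
          ext <;> simp
        have h3 := h2.mul ((hF' _ (hrec x hx).2).comp x (hPd x))
        exact h3)
      (by
        have h1 : IntegrableOn (fun x => 2 * J x) (uIcc ε L ×ˢ uIcc (-π) π) := by
          rw [uIcc_of_le hεL.le, uIcc_of_le hpi]
          exact (hJi ε L).const_mul 2
        refine h1.congr ?_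
        have hae : ∀ᵐ x : ℝ × ℝ, x ∉ s := by
          have := hs.ae_notMem (volume : Measure (ℝ × ℝ))
          exact this
        have hae2 : (uIcc ε L ×ˢ uIcc (-π) π) =ᵐ[volume] (Ioo ε L ×ˢ Ioo (-π) π) := by
          rw [uIcc_of_le hεL.le, uIcc_of_le hpi]
          exact Measure.set_prod_ae_eq Ioo_ae_eq_Icc.symm Ioo_ae_eq_Icc.symm
        rw [Measure.restrict_congr_set hae2]
        rw [EventuallyEq, ae_restrict_iff' (measurableSet_Ioo.prod measurableSet_Ioo)]
        filter_upwards [hae] with x hx hx2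
        have h4 : 0 < x.1 := hε.trans hx2.1.1
        exact (hsum x h4 (fun h => hx ⟨⟨h4, hx2.2⟩, h⟩)).symm)
    have hl : ∫ r in ε..L, 2 * j r
        = ∫ x in ε..L, ∫ y in (-π)..π, f' (x, y) (1, 0) + g' (x, y) (0, 1) := by
      refine intervalIntegral.integral_congr_ae ?_
      have hae : ∀ᵐ r : ℝ, r ≠ ‖z‖ := by
        have := (Set.countable_singleton ‖z‖).ae_notMem (volume : Measure ℝ)
        exact this
      filter_upwards [hae] with r hr hr2
      rw [uIoc_of_le hεL.le] at hr2
      have hr0 : 0 < r := hε.trans hr2.1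
      simp only [hj]
      rw [← intervalIntegral.integral_const_mul]
      refine intervalIntegral.integral_congr (fun t _ => ?_)
      refine (hsum (r, t) hr0 ?_).symm
      intro h
      apply hr
      have h2 : ‖(r:ℂ) * Complex.exp (t * I)‖ = r := by
        rw [norm_mul, Complex.norm_exp_ofReal_mul_I, mul_one, Complex.norm_real,
          Real.norm_of_nonneg hr0.le]
      rw [← h2, ← norm_neg z]
      congr 1
      simp only [hP] at h
      linear_combination h
    rw [hl, this]
    have hper : ∀ x : ℝ, P (x, π) = P (x, -π) := by
      intro x
      simp only [hP]
      have : Complex.exp ((-π : ℝ) * I) = Complex.exp (π * I) := by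
        rw [Complex.exp_pi_mul_I]
        push_cast
        rw [neg_mul, Complex.exp_neg, Complex.exp_pi_mul_I]; norm_num
      rw [this]
    have hout : ∀ t : ℝ, F (P (L, t)) = 0 := by
      intro t
      apply hF
      have h2 : ‖(L:ℂ) * Complex.exp (t * I)‖ = L := by
        rw [norm_mul, Complex.norm_exp_ofReal_mul_I, mul_one, Complex.norm_real,
          Real.norm_of_nonneg hL0.le]
      have := norm_sub_le (z + L * Complex.exp (t * I)) z
      rw [add_sub_cancel_left, h2] at this
      simp only [hP]
      linarith
    simp only [hper, hout, sub_self, zero_add, intervalIntegral.integral_zero, zero_sub]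
  have hJi2 : IntegrableOn J (Ioc 0 L ×ˢ Ioc (-π) π) :=
    (hJi 0 L).mono_set (Set.prod_mono Ioc_subset_Icc_self Ioc_subset_Icc_self)
  have hI : ∫ ζ, G ζ / (ζ - z) = ∫ r in (0:ℝ)..L, j r := by
    rw [K2 G z R hG L (by linarith), intervalIntegral.integral_of_le hL0.le]
    rw [Measure.volume_eq_prod, setIntegral_prod _ hJi2]
    simp only [hj, intervalIntegral.integral_of_le hpi, hJ, hP]
  have hji : IntervalIntegrable j volume 0 L := by
    rw [intervalIntegrable_iff_integrableOn_Ioc_of_le hL0.le]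
    have h1 := hJi2
    rw [IntegrableOn, Measure.volume_eq_prod, ← Measure.prod_restrict] at h1
    have := h1.integral_prod_left
    simpa only [hj, intervalIntegral.integral_of_le hpi, IntegrableOn] using this
  have hlim1 : Tendsto (fun ε => 2 * (∫ r in (0:ℝ)..L, j r) - 2 * ∫ r in (0:ℝ)..ε, j r) (𝓝[Ioo 0 L] 0)
      (𝓝 (2 * (∫ r in (0:ℝ)..L, j r) - 2 * 0)) := by
    refine Tendsto.sub tendsto_const_nhds (Tendsto.const_mul _ ?_)
    have h1 := intervalIntegral.continuousOn_primitive_interval' hji left_mem_uIcc 0 left_mem_uIcc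
    have h2 : Tendsto (fun ε => ∫ r in (0:ℝ)..ε, j r) (𝓝[uIcc 0 L] 0) (𝓝 (∫ r in (0:ℝ)..0, j r)) := h1
    rw [intervalIntegral.integral_same] at h2
    refine h2.mono_left (nhdsWithin_mono _ ?_)
    rw [uIcc_of_le hL0.le]; exact Ioo_subset_Icc_self
  have hlim2 : Tendsto (fun ε => - ∫ t in (-π)..π, F (P (ε, t))) (𝓝[Ioo 0 L] 0)
      (𝓝 (- ∫ t in (-π)..π, F (P (0, t)))) := by
    have h1 : Continuous (fun ε => ∫ t in (-π)..π, F (P (ε, t))) :=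
      intervalIntegral.continuous_parametric_intervalIntegral_of_continuous' (by
        exact hc.comp (hPc.comp continuous_id)) _ _
    exact ((h1.tendsto 0).neg).mono_left nhdsWithin_le_nhds
  have hne : (𝓝[Ioo 0 L] (0:ℝ)).NeBot := by
    rw [← mem_closure_iff_nhdsWithin_neBot, closure_Ioo hL0.ne]
    exact ⟨le_rfl, hL0.le⟩
  have heq := tendsto_nhds_unique (hlim1.congr' (by
    filter_upwards [self_mem_nhdsWithin] with ε hε
    rw [← key ε hε, intervalIntegral.integral_const_mul]
    have hsub : IntervalIntegrable j volume 0 ε := hji.mono_set (by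
      rw [uIcc_of_le hL0.le, uIcc_of_le hε.1.le]; exact Icc_subset_Icc_right hε.2.le)
    have hsub2 : IntervalIntegrable j volume ε L := hji.mono_set (by
      rw [uIcc_of_le hL0.le, uIcc_of_le hε.2.le]; exact Icc_subset_Icc_left hε.1.le)
    rw [← intervalIntegral.integral_add_adjacent_intervals hsub hsub2]; ring)) hlim2
  have h0 : ∀ t : ℝ, P (0, t) = z := by intro t; simp [hP]
  simp only [h0, intervalIntegral.integral_const] at heq
  rw [hI]
  have h5 : ((π - -π : ℝ) • F z) = 2 * π * F z := by
    rw [Complex.real_smul]; push_cast; ring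
  rw [h5] at heq
  linear_combination heq / 2

lemma setup (w g : ℂ → ℂ) (hw : ContDiff ℝ 1 w) (hg : Continuous g)
    (hwg : ∀ z, fderiv ℝ w z 1 + I * fderiv ℝ w z I = 2 * g z) (R : ℝ) (hR : 0 < R) :
    ∃ (N : ℂ → ℂ) (E : ℝ), 0 ≤ E ∧ Continuous N ∧ (∀ ζ, ‖N ζ‖ ≤ E) ∧ (∀ ζ, 2 * R < ‖ζ‖ → N ζ = 0) ∧
      (∀ ζ, ‖ζ‖ < R → N ζ = g ζ) ∧
      ∀ (n : ℕ) (M r : ℝ), 0 < r → (∀ z, ‖z‖ ≤ r → ‖w z‖ ≤ M * ‖z‖ ^ (n + 1)) →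
        ∀ B, (∀ ζ, ‖N ζ / ζ ^ n‖ ≤ B) → ∀ z, ‖z‖ ≤ R →
          ∫ ζ, (N ζ / ζ ^ n) / (ζ - z) = - π * (w z / z ^ n) := by
  let χ : ContDiffBump (0:ℂ) := ⟨R, 2 * R, hR, by linarith⟩
  have hχ : ContDiff ℝ 1 (χ : ℂ → ℝ) := χ.contDiff
  have hχd : Continuous (fderiv ℝ (χ : ℂ → ℝ)) := hχ.continuous_fderiv (by norm_num)
  have hout : ∀ ζ : ℂ, 2 * R < ‖ζ‖ → χ =ᶠ[𝓝 ζ] 0 := by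
    intro ζ hζ
    have : {x : ℂ | 2 * R < ‖x‖} ∈ 𝓝 ζ := (isOpen_lt continuous_const continuous_norm).mem_nhds hζ
    filter_upwards [this] with x hx
    exact χ.zero_of_le_dist (by rw [dist_zero_right]; exact le_of_lt hx)
  have hin : ∀ ζ : ℂ, ‖ζ‖ < R → χ =ᶠ[𝓝 ζ] 1 := by
    intro ζ hζ
    have : {x : ℂ | ‖x‖ < R} ∈ 𝓝 ζ := (isOpen_lt continuous_norm continuous_const).mem_nhds hζ
    filter_upwards [this] with x hx
    exact χ.one_of_mem_closedBall (by rw [mem_closedBall_zero_iff]; exact le_of_lt hx)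
  let N : ℂ → ℂ := fun z => χ z * g z + w z *
    ((1/2) * ((fderiv ℝ χ z 1 : ℂ) + I * (fderiv ℝ χ z I : ℂ)))
  have hNc : Continuous N := by
    have h1 : Continuous (χ : ℂ → ℝ) := χ.continuous
    have h2 := hw.continuous
    have h3 : Continuous (fun z => fderiv ℝ χ z 1) := hχd.clm_apply continuous_const
    have h4 : Continuous (fun z => fderiv ℝ χ z I) := hχd.clm_apply continuous_const
    simp only [N]
    fun_prop
  have hN0 : ∀ ζ, 2 * R < ‖ζ‖ → N ζ = 0 := by
    intro ζ hζ
    have h1 : fderiv ℝ χ ζ = 0 := by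
      rw [(hout ζ hζ).fderiv_eq]; simp
    have h2 : χ ζ = 0 := (hout ζ hζ).eq_of_nhds
    simp [N, h1, h2]
  have hN1 : ∀ ζ, ‖ζ‖ < R → N ζ = g ζ := by
    intro ζ hζ
    have h1 : fderiv ℝ χ ζ = 0 := by
      rw [(hin ζ hζ).fderiv_eq]; exact fderiv_const_apply (1:ℝ)
    have h2 : χ ζ = 1 := (hin ζ hζ).eq_of_nhds
    simp [N, h1, h2]
  obtain ⟨E, hE⟩ := (isCompact_closedBall (0:ℂ) (2 * R)).exists_bound_of_continuousOn hNc.continuousOn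
  have hE0 : 0 ≤ E := (norm_nonneg _).trans (hE 0 (by simp [hR.le]))
  refine ⟨N, E, hE0, hNc, ?_, hN0, hN1, ?_⟩
  · intro ζ
    by_cases h : ‖ζ‖ ≤ 2 * R
    · exact hE ζ (by simpa using h)
    · rw [hN0 ζ (not_le.1 h)]; simpa
  intro n M r hr hwM B hB z hz
  have hw0 : w 0 = 0 := by
    have := hwM 0 (by simpa using hr.le)
    simpa using this
  let F : ℂ → ℂ := fun ζ => χ ζ * w ζ / ζ ^ n
  have hFz : F z = w z / z ^ n := by
    simp only [F]
    rw [χ.one_of_mem_closedBall (by rw [mem_closedBall_zero_iff]; exact hz)]; simp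
  have hd : ∀ ζ, ζ ≠ 0 → ∃ F' : ℂ →L[ℝ] ℂ, HasFDerivAt F F' ζ ∧ F' 1 + I * F' I = 2 * (N ζ / ζ ^ n) := by
    intro ζ hζ
    have h1 : HasFDerivAt (fun x => (χ x : ℂ)) (Complex.ofRealCLM.comp (fderiv ℝ χ ζ)) ζ :=
      Complex.ofRealCLM.hasFDerivAt.comp ζ (hχ.differentiable (by norm_num) ζ).hasFDerivAt
    have h2 : HasFDerivAt w (fderiv ℝ w ζ) ζ := (hw.differentiable (by norm_num) ζ).hasFDerivAt
    have h3 : HasDerivAt (fun x : ℂ => (x ^ n)⁻¹) (-(n * ζ ^ (n-1)) / (ζ ^ n)^2) ζ :=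
      (hasDerivAt_pow n ζ).inv (pow_ne_zero _ hζ)
    have h4 := h3.hasFDerivAt.restrictScalars ℝ
    have h5 := (h1.mul h2).mul h4
    refine ⟨_, h5, ?_⟩
    simp only [N, add_apply, smul_apply, smul_eq_mul, ContinuousLinearMap.comp_apply,
      ContinuousLinearMap.coe_restrictScalars', ContinuousLinearMap.toSpanSingleton_apply,
      Complex.ofRealCLM_apply, Pi.mul_apply]
    generalize (-(n * ζ ^ (n-1)) / (ζ ^ n)^2) = D
    rw [div_eq_mul_inv]
    linear_combination (χ ζ * (ζ ^ n)⁻¹ : ℂ) * hwg ζ + (χ ζ * w ζ * D) * I_sq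
  have hFc : Continuous F := by
    rw [continuous_iff_continuousAt]
    intro ζ
    by_cases hζ : ζ = 0
    · subst hζ
      have hF0 : F 0 = 0 := by simp [F, hw0]
      rw [ContinuousAt, hF0]
      refine squeeze_zero_norm' (a := fun x => M * ‖x‖) ?_ ?_
      · filter_upwards [Metric.closedBall_mem_nhds (0:ℂ) hr] with x hx
        rw [mem_closedBall_zero_iff] at hx
        by_cases hx0 : x = 0
        · simp [hx0, hF0]
        have hxp : 0 < ‖x‖ := norm_pos_iff.2 hx0
        simp only [F]
        rw [norm_div, norm_mul, norm_pow, div_le_iff₀ (by positivity)]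
        have h1 : ‖(χ x : ℂ)‖ ≤ 1 := by
          rw [Complex.norm_real, Real.norm_of_nonneg χ.nonneg]; exact χ.le_one
        calc _ ≤ 1 * ‖w x‖ := by gcongr
          _ ≤ M * ‖x‖ ^ (n+1) := by rw [one_mul]; exact hwM x hx
          _ = _ := by ring
      · have : Continuous (fun x : ℂ => M * ‖x‖) := by fun_prop
        simpa using this.tendsto 0
    · obtain ⟨F', h, _⟩ := hd ζ hζ
      exact h.continuousAt
  rw [← hFz]
  refine CP F (fun ζ => N ζ / ζ ^ n) hFc (by have := hNc.measurable; fun_prop) (2 * R) B (by positivity) ?_ ?_ hB hd z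
  · intro ζ hζ
    have h2 : χ ζ = 0 := (hout ζ hζ).eq_of_nhds
    simp [F, h2]
  · intro ζ hζ
    simp [hN0 ζ hζ]

lemma stepA (w g : ℂ → ℂ) (hw : ContDiff ℝ 1 w) (hg : Continuous g)
    (hwg : ∀ z, fderiv ℝ w z 1 + I * fderiv ℝ w z I = 2 * g z) (n : ℕ) (M M' : ℝ)
    (hM : ∀ z, ‖z‖ ≤ 2 → ‖w z‖ ≤ M * ‖z‖ ^ (n + 1))
    (hM' : ∀ z, ‖z‖ ≤ 2 → ‖g z‖ ≤ M' * ‖z‖ ^ (n + 2)) :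
    ∃ (c : ℂ) (C : ℝ), ∀ z, ‖z‖ ≤ 1 → ‖w z - c * z ^ (n + 1)‖ ≤ C * ‖z‖ ^ (n + 2) := by
  obtain ⟨N, E, hE0, hNc, hNE, hN0, hN1, hcp⟩ := setup w g hw hg hwg 1 one_pos
  have hw0 : w 0 = 0 := by
    have := hM 0 (by simp)
    simpa using this
  have hN00 : N 0 = 0 := by
    rw [hN1 0 (by simp)]
    have := hM' 0 (by simp)
    simpa using this
  set D := max E M' with hD
  have hD0 : 0 ≤ D := hE0.trans (le_max_left _ _)
  have hND : ∀ ζ, ‖N ζ‖ ≤ D * ‖ζ‖ ^ (n+2) := by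
    intro ζ
    by_cases h : ‖ζ‖ < 1
    · rw [hN1 ζ h]
      exact (hM' ζ (by linarith)).trans (by gcongr; exact le_max_right _ _)
    · have : 1 ≤ ‖ζ‖ ^ (n+2) := one_le_pow₀ (not_lt.1 h)
      calc _ ≤ E := hNE ζ
        _ ≤ D := le_max_left _ _
        _ ≤ _ := le_mul_of_one_le_right hD0 this
  have hk : ∀ k ≤ 2, ∀ ζ, ‖N ζ / ζ ^ n / ζ ^ k‖ ≤ D * 4 := by
    intro k hk ζ
    by_cases hζ0 : ζ = 0
    · simp [hζ0, hN00]; positivity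
    by_cases hζ2 : 2 * 1 < ‖ζ‖
    · rw [hN0 ζ hζ2]; simp; positivity
    have hζp : 0 < ‖ζ‖ := norm_pos_iff.2 hζ0
    rw [norm_div, norm_div, norm_pow, norm_pow, div_le_iff₀ (by positivity), div_le_iff₀ (by positivity)]
    refine (hND ζ).trans ?_
    have : ‖ζ‖ ^ (2 - k) ≤ 4 := by
      rw [not_lt] at hζ2
      have h2 : ‖ζ‖ ≤ 2 := by linarith
      interval_cases k
      · norm_num; nlinarith
      · norm_num; linarith
      · norm_num
    have h2 : ‖ζ‖ ^ (n+2) = ‖ζ‖ ^ (2 - k) * ‖ζ‖ ^ k * ‖ζ‖ ^ n := by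
      rw [← pow_add, ← pow_add]; congr 1; omega
    rw [h2]
    calc _ = D * ‖ζ‖ ^ (2 - k) * ‖ζ‖ ^ k * ‖ζ‖ ^ n := by ring
      _ ≤ _ := by gcongr
  have hmeas : Measurable (fun ζ => N ζ / ζ ^ n) := by
    have := hNc.measurable
    fun_prop
  set G : ℂ → ℂ := fun ζ => N ζ / ζ ^ n with hG
  have hG0 : ∀ ζ, 2 < ‖ζ‖ → G ζ = 0 := fun ζ h => by simp [hG, hN0 ζ (by linarith)]
  have hcp' := hcp n M 2 (by norm_num) hM (D * 4) (by simpa using hk 0 (by norm_num))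
  have h00 : ∫ ζ, G ζ / (ζ - 0) = 0 := by
    rw [hcp' 0 (by simp), hw0]; simp
  set c0 := ∫ ζ, (G ζ / ζ) / (ζ - 0) with hc0
  have hpi : (π : ℂ) ≠ 0 := by exact_mod_cast pi_ne_zero
  refine ⟨-c0 / π, 1 / π * (D * 4 * (2 * π * (2 + 1))), fun z hz => ?_⟩
  set c1 := ∫ ζ, (G ζ / ζ ^ 2) / (ζ - z) with hc1
  have i0 : Integrable (fun ζ => G ζ / (ζ - 0)) := K_int G hmeas 0 2 (D * 4) hG0
    (fun ζ => by have := hk 0 (by norm_num) ζ; rwa [pow_zero, div_one] at this)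
  have i1 : Integrable (fun ζ => (G ζ / ζ) / (ζ - 0)) :=
    K_int (fun ζ => G ζ / ζ) (by fun_prop) 0 2 (D * 4) (fun ζ h => by simp [hG0 ζ h])
      (fun ζ => by have := hk 1 (by norm_num) ζ; rwa [pow_one] at this)
  have i2 : Integrable (fun ζ => (G ζ / ζ ^ 2) / (ζ - z)) :=
    K_int (fun ζ => G ζ / ζ ^ 2) (by fun_prop) z 2 (D * 4) (fun ζ h => by simp [hG0 ζ h])
      (hk 2 (by norm_num))
  have hb1 : ‖c1‖ ≤ D * 4 * (2 * π * (2 + ‖z‖)) :=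
    K_bound (fun ζ => G ζ / ζ ^ 2) z 2 (D * 4) (by norm_num) (fun ζ h => by simp [hG0 ζ h])
      (hk 2 (by norm_num))
  have hexp : - π * (w z / z ^ n) = z * c0 + z ^ 2 * c1 := by
    rw [← hcp' z hz]
    have : ∫ ζ, G ζ / (ζ - z) = ∫ ζ, (G ζ / (ζ - 0) + z * ((G ζ / ζ) / (ζ - 0)) + z ^ 2 * ((G ζ / ζ ^ 2) / (ζ - z))) := by
      refine integral_congr_ae ?_
      have hae : ∀ᵐ ζ : ℂ, ζ ≠ z := by
        have := (Set.countable_singleton z).ae_notMem (volume : Measure ℂ)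
        exact this
      filter_upwards [hae] with ζ hζ
      by_cases h : ζ = 0
      · have : G 0 = 0 := by simp [hG, hN00]
        rw [h, this]; simp
      have h2 : ζ - z ≠ 0 := sub_ne_zero.2 hζ
      rw [sub_zero]
      field_simp
      ring
    have i01 : Integrable (fun ζ => G ζ / (ζ - 0) + z * ((G ζ / ζ) / (ζ - 0))) :=
      i0.add (i1.const_mul z)
    refine this.trans ?_
    rw [integral_add i01 (i2.const_mul _), integral_add i0 (i1.const_mul z),
      h00, integral_const_mul, integral_const_mul]
    ring
  by_cases hz0 : z = 0
  · simp [hz0, hw0]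
  have hzn : z ^ n ≠ 0 := pow_ne_zero _ hz0
  have hwz : w z - -c0 / π * z ^ (n+1) = - (1 / π) * c1 * z ^ (n+2) := by
    have h1 : w z = (w z / z ^ n) * z ^ n := by field_simp
    have h2 : w z / z ^ n = - (1/π) * (z * c0 + z ^ 2 * c1) := by
      rw [← hexp]; field_simp
    rw [h1, h2]; ring
  rw [hwz, norm_mul, norm_mul, norm_neg, norm_pow]
  have h3 : ‖(1 / π : ℂ)‖ = 1 / π := by
    rw [norm_div, Complex.norm_real, Real.norm_of_nonneg pi_pos.le, norm_one]
  rw [h3]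
  gcongr
  refine hb1.trans ?_
  gcongr

lemma stepB (w g : ℂ → ℂ) (hw : ContDiff ℝ 1 w) (hg : Continuous g)
    (hwg : ∀ z, fderiv ℝ w z 1 + I * fderiv ℝ w z I = 2 * g z) (C : ℝ) (hC : 0 ≤ C)
    (hM : ∀ n : ℕ, ∃ M, ∀ z, ‖z‖ ≤ 2 → ‖w z‖ ≤ M * ‖z‖ ^ n)
    (hgw : ∀ (n : ℕ) (M ρ : ℝ), 0 ≤ M → ρ ≤ 2 → (∀ z, ‖z‖ ≤ ρ → ‖w z‖ ≤ M * ‖z‖ ^ n) →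
      ∀ z, ‖z‖ ≤ ρ → ‖g z‖ ≤ C * M * ‖z‖ ^ (n + 1)) :
    ∃ R > 0, ∀ z, ‖z‖ < R → w z = 0 := by
  set R : ℝ := 1 / (12 * C + 12) with hRdef
  have hR : 0 < R := by positivity
  have hR1 : R ≤ 1 := by rw [hRdef, div_le_one (by positivity)]; linarith
  have hRC : 6 * C * R ≤ 1 / 2 := by
    rw [hRdef, mul_one_div, div_le_iff₀ (by positivity)]; linarith
  obtain ⟨N, E, hE0, hNc, hNE, hN0, hN1, hcp⟩ := setup w g hw hg hwg R hR
  have hw0 : w 0 = 0 := by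
    obtain ⟨M, h⟩ := hM 1
    have := h 0 (by simp)
    simpa using this
  have main : ∀ n : ℕ, ∀ z, ‖z‖ ≤ R → ‖w z‖ ≤ 12 * R * E * (‖z‖ / R) ^ n := by
    intro n
    obtain ⟨M0, hM0⟩ := hM (n+1)
    -- maximum of |w/z^n|
    have hcont : ContinuousOn (fun z : ℂ => ‖w z / z ^ n‖) (Metric.closedBall 0 R) := by
      intro z hz
      apply ContinuousAt.continuousWithinAt
      by_cases hz0 : z = 0
      · subst hz0
        rw [ContinuousAt]
        have : ‖w 0 / 0 ^ n‖ = 0 := by simp [hw0]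
        rw [this]
        refine squeeze_zero_norm' (a := fun x => M0 * ‖x‖) ?_ ?_
        · filter_upwards [Metric.closedBall_mem_nhds (0:ℂ) (zero_lt_two)] with x hx
          rw [mem_closedBall_zero_iff] at hx
          by_cases hx0 : x = 0
          · simp [hx0, hw0]
          have hxp : 0 < ‖x‖ := norm_pos_iff.2 hx0
          rw [norm_norm, norm_div, norm_pow, div_le_iff₀ (by positivity)]
          calc _ ≤ M0 * ‖x‖ ^ (n+1) := hM0 x hx
            _ = _ := by ring
        · have : Continuous (fun x : ℂ => M0 * ‖x‖) := by fun_prop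
          simpa using this.tendsto 0
      · have := hw.continuous
        refine ContinuousAt.norm (ContinuousAt.div (by fun_prop) (by fun_prop) (pow_ne_zero _ hz0))
    obtain ⟨zs, hzs, hmax⟩ := (isCompact_closedBall (0:ℂ) R).exists_isMaxOn ⟨0, by simp [hR.le]⟩ hcont
    set M := ‖w zs / zs ^ n‖ with hMdef
    have hMM : 0 ≤ M := norm_nonneg _
    rw [mem_closedBall_zero_iff] at hzs
    have hwM : ∀ z, ‖z‖ ≤ R → ‖w z‖ ≤ M * ‖z‖ ^ n := by
      intro z hz
      by_cases hz0 : z = 0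
      · rw [hz0, hw0, norm_zero]; positivity
      have hzp : 0 < ‖z‖ := norm_pos_iff.2 hz0
      have h1 : ‖w z / z ^ n‖ ≤ M := hmax (by simpa using hz)
      rwa [norm_div, norm_pow, div_le_iff₀ (by positivity)] at h1
    have hgM := hgw n M R hMM (by linarith) hwM
    have hB : ∀ ζ, ‖N ζ / ζ ^ n‖ ≤ C * M * R + E / R ^ n := by
      intro ζ
      have p1 : 0 ≤ E / R ^ n := by positivity
      have p2 : 0 ≤ C * M * R := by positivity
      by_cases h : ‖ζ‖ < R
      · rw [hN1 ζ h]
        by_cases hz0 : ζ = 0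
        · have : g 0 = 0 := by
            have := hgM 0 (by simp [hR.le])
            simpa using this
          rw [hz0, this, zero_div, norm_zero]; positivity
        have hzp : 0 < ‖ζ‖ := norm_pos_iff.2 hz0
        have : ‖g ζ / ζ ^ n‖ ≤ C * M * R := by
          rw [norm_div, norm_pow, div_le_iff₀ (by positivity)]
          calc _ ≤ C * M * ‖ζ‖ ^ (n+1) := hgM ζ h.le
            _ = C * M * ‖ζ‖ * ‖ζ‖ ^ n := by ring
            _ ≤ _ := by gcongr
        linarith
      · have : ‖N ζ / ζ ^ n‖ ≤ E / R ^ n := by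
          rw [norm_div, norm_pow]
          exact div_le_div₀ hE0 (hNE ζ) (by positivity) (pow_le_pow_left₀ hR.le (not_lt.1 h) n)
        linarith
    have h1 := hcp n M0 2 (by norm_num) hM0 _ hB zs hzs
    have h2 := K_bound (fun ζ => N ζ / ζ ^ n) zs (2 * R) _ (by positivity)
      (fun ζ h => by simp [hN0 ζ h]) hB
    rw [h1, norm_mul, norm_neg, Complex.norm_real, Real.norm_of_nonneg pi_pos.le, ← hMdef] at h2
    have h3 : π * M ≤ π * (2 * (C * M * R + E / R ^ n) * (3 * R)) := by
      refine h2.trans ?_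
      have p : 0 ≤ C * M * R + E / R ^ n := by positivity
      calc _ ≤ (C * M * R + E / R ^ n) * (2 * π * (2 * R + R)) := by gcongr
        _ = _ := by ring
    have h4 := le_of_mul_le_mul_left h3 pi_pos
    have h5 : 6 * C * R * (M * R) ≤ 1 / 2 * M := by
      have : M * R ≤ M := mul_le_of_le_one_right hMM hR1
      have p : 0 ≤ M * R := by positivity
      calc _ ≤ 1 / 2 * (M * R) := by gcongr
        _ ≤ _ := by gcongr
    have h6 : M ≤ 12 * R * (E / R ^ n) := by nlinarith
    intro z hz
    calc _ ≤ M * ‖z‖ ^ n := hwM z hz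
      _ ≤ 12 * R * (E / R ^ n) * ‖z‖ ^ n := by gcongr
      _ = _ := by rw [div_pow]; ring
  refine ⟨R, hR, fun z hz => ?_⟩
  have hlim : Tendsto (fun n : ℕ => 12 * R * E * (‖z‖ / R) ^ n) atTop (𝓝 (12 * R * E * 0)) :=
    (tendsto_pow_atTop_nhds_zero_of_lt_one (by positivity) ((div_lt_one hR).2 hz)).const_mul _
  have := ge_of_tendsto' hlim (fun n => main n z hz.le)
  simpa using this

/-- The complex gradient `u_x - i u_y`. -/
noncomputable def cgrad (u : ℂ → ℝ) (z : ℂ) : ℂ := (fderiv ℝ u z 1 : ℂ) - I * (fderiv ℝ u z I : ℂ)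

lemma norm_fderiv_le_cgrad (u : ℂ → ℝ) (z : ℂ) : ‖fderiv ℝ u z‖ ≤ ‖cgrad u z‖ := by
  refine ContinuousLinearMap.opNorm_le_bound _ (norm_nonneg _) (fun v => ?_)
  have h : fderiv ℝ u z v = (cgrad u z * v).re := by
    conv_lhs => rw [show v = v.re • (1:ℂ) + v.im • I by simp]
    rw [map_add, map_smul, map_smul]
    simp [cgrad]
    ring
  rw [h, ← norm_mul, Real.norm_eq_abs]
  exact Complex.abs_re_le_norm _

lemma mean_value (v : ℂ → ℝ) (hv : Differentiable ℝ v) (h0 : v 0 = 0) (n : ℕ) (M ρ : ℝ) (hM : 0 ≤ M)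
    (h : ∀ z, ‖z‖ ≤ ρ → ‖cgrad v z‖ ≤ M * ‖z‖ ^ n) :
    ∀ z, ‖z‖ ≤ ρ → |v z| ≤ M * ‖z‖ ^ (n + 1) := by
  intro z hz
  have := (convex_closedBall (0:ℂ) ‖z‖).norm_image_sub_le_of_norm_fderiv_le (𝕜 := ℝ) (f := v)
    (C := M * ‖z‖ ^ n) (x := 0) (y := z) (fun x _ => hv x) (by
      intro x hx
      rw [mem_closedBall_zero_iff] at hx
      refine (norm_fderiv_le_cgrad v x).trans ((h x (hx.trans hz)).trans ?_)
      gcongr) (by simp) (by simp)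
  rw [h0, sub_zero, sub_zero, Real.norm_eq_abs] at this
  rw [pow_succ, ← mul_assoc]; exact this

lemma contDiff_cgrad (u : ℂ → ℝ) (hu : ContDiff ℝ 2 u) : ContDiff ℝ 1 (cgrad u) := by
  have h1 : ContDiff ℝ 1 (fderiv ℝ u) := hu.fderiv_right (by norm_num)
  have h2 : ContDiff ℝ 1 (fun z => (fderiv ℝ u z 1 : ℂ)) :=
    Complex.ofRealCLM.contDiff.comp (h1.clm_apply contDiff_const)
  have h3 : ContDiff ℝ 1 (fun z => (fderiv ℝ u z I : ℂ)) :=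
    Complex.ofRealCLM.contDiff.comp (h1.clm_apply contDiff_const)
  exact h2.sub (contDiff_const.mul h3)

lemma dbar_cgrad (u : ℂ → ℝ) (hu : ContDiff ℝ 2 u) (z : ℂ) :
    fderiv ℝ (cgrad u) z 1 + I * fderiv ℝ (cgrad u) z I =
      ((fderiv ℝ (fun z => fderiv ℝ u z 1) z 1 + fderiv ℝ (fun z => fderiv ℝ u z I) z I : ℝ) : ℂ) := by
  have h1 : ContDiff ℝ 1 (fderiv ℝ u) := hu.fderiv_right (by norm_num)
  have hd : HasFDerivAt (fderiv ℝ u) (fderiv ℝ (fderiv ℝ u) z) z :=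
    (h1.differentiable (by norm_num) z).hasFDerivAt
  have hv : ∀ v : ℂ, HasFDerivAt (fun z => fderiv ℝ u z v)
      ((ContinuousLinearMap.apply ℝ ℝ v).comp (fderiv ℝ (fderiv ℝ u) z)) z := fun v =>
    (ContinuousLinearMap.apply ℝ ℝ v).hasFDerivAt.comp z hd
  have hc : ∀ v : ℂ, HasFDerivAt (fun z => (fderiv ℝ u z v : ℂ))
      (Complex.ofRealCLM.comp ((ContinuousLinearMap.apply ℝ ℝ v).comp (fderiv ℝ (fderiv ℝ u) z))) z := fun v =>
    Complex.ofRealCLM.hasFDerivAt.comp z (hv v)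
  have hw := (hc 1).sub ((hc I).const_mul I)
  have hs := (hu.contDiffAt (x := z)).isSymmSndFDerivAt (by simp) 1 I
  rw [show cgrad u = fun z => (fderiv ℝ u z 1 : ℂ) - I * (fderiv ℝ u z I : ℂ) from rfl]
  rw [show (fun z => (fderiv ℝ u z 1 : ℂ) - I * (fderiv ℝ u z I : ℂ))
    = (fun z => (fderiv ℝ u z 1 : ℂ)) - (fun z => I * (fderiv ℝ u z I : ℂ)) from rfl]
  rw [hw.fderiv, (hv 1).fderiv, (hv I).fderiv]
  simp [hs]
  linear_combination (-(fderiv ℝ (fderiv ℝ u) z I I : ℂ)) * I_sq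

lemma local_alt (u κ : ℂ → ℝ) (hu : ContDiff ℝ 2 u) (hκ : Continuous κ)
    (hpde : ∀ z, fderiv ℝ (fun z => fderiv ℝ u z 1) z 1 + fderiv ℝ (fun z => fderiv ℝ u z I) z I
      + κ z * u z = 0) (h0 : u 0 = 0) (hg0 : fderiv ℝ u 0 = 0) :
    (∀ᶠ z in 𝓝 (0:ℂ), u z = 0) ∨
    ∃ (n : ℕ) (c : ℂ) (C : ℝ), c ≠ 0 ∧
      ∀ z, ‖z‖ ≤ 1 → ‖cgrad u z - c * z ^ (n + 1)‖ ≤ C * ‖z‖ ^ (n + 2) := by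
  set w := cgrad u with hwdef
  have hw : ContDiff ℝ 1 w := contDiff_cgrad u hu
  have hw0 : w 0 = 0 := by simp [hwdef, cgrad, hg0]
  have hud : Differentiable ℝ u := hu.differentiable (by norm_num)
  set g : ℂ → ℂ := fun z => ((-(1/2) * (κ z * u z) : ℝ) : ℂ) with hgdef
  have hg : Continuous g := by
    have := hu.continuous
    fun_prop
  have hwg : ∀ z, fderiv ℝ w z 1 + I * fderiv ℝ w z I = 2 * g z := by
    intro z
    rw [hwdef, dbar_cgrad u hu z, hgdef]
    have := hpde z
    rw [show (2:ℂ) = ((2:ℝ):ℂ) by norm_num, ← Complex.ofReal_mul]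
    congr 1
    linarith
  obtain ⟨C, hC⟩ := (isCompact_closedBall (0:ℂ) 2).exists_bound_of_continuousOn hκ.continuousOn
  have hC0 : 0 ≤ C := (norm_nonneg _).trans (hC 0 (by simp))
  have hgw : ∀ (n : ℕ) (M ρ : ℝ), 0 ≤ M → ρ ≤ 2 → (∀ z, ‖z‖ ≤ ρ → ‖w z‖ ≤ M * ‖z‖ ^ n) →
      ∀ z, ‖z‖ ≤ ρ → ‖g z‖ ≤ C * M * ‖z‖ ^ (n + 1) := by
    intro n M ρ hM hρ h z hz
    have h1 := mean_value u hud h0 n M ρ hM h z hz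
    have h2 := hC z (by simpa using hz.trans hρ)
    rw [Real.norm_eq_abs] at h2
    simp only [hgdef]
    rw [Complex.norm_real, Real.norm_eq_abs, abs_mul, abs_mul]
    have h3 : |(-(1/2) : ℝ)| ≤ 1 := by rw [abs_neg, abs_of_pos] <;> norm_num
    calc _ ≤ 1 * (C * (M * ‖z‖ ^ (n+1))) := by gcongr
      _ = _ := by ring
  by_cases hex : ∃ (n : ℕ) (c : ℂ) (C : ℝ), c ≠ 0 ∧
      ∀ z, ‖z‖ ≤ 1 → ‖w z - c * z ^ (n + 1)‖ ≤ C * ‖z‖ ^ (n + 2)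
  · exact Or.inr hex
  left
  -- passing from local to global bounds
  have ext : ∀ (n : ℕ) (M r : ℝ), 0 < r → (∀ z, ‖z‖ ≤ r → ‖w z‖ ≤ M * ‖z‖ ^ n) →
      ∃ M', 0 ≤ M' ∧ ∀ z, ‖z‖ ≤ 2 → ‖w z‖ ≤ M' * ‖z‖ ^ n := by
    intro n M r hr h
    obtain ⟨E, hE⟩ := (isCompact_closedBall (0:ℂ) 2).exists_bound_of_continuousOn hw.continuous.continuousOn
    have hE0 : 0 ≤ E := (norm_nonneg _).trans (hE 0 (by simp))
    refine ⟨max M (E / r ^ n), le_max_of_le_right (by positivity), fun z hz => ?_⟩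
    by_cases hzr : ‖z‖ ≤ r
    · exact (h z hzr).trans (by gcongr; exact le_max_left _ _)
    · have h1 : r ^ n ≤ ‖z‖ ^ n := pow_le_pow_left₀ hr.le (not_le.1 hzr).le n
      calc _ ≤ E := hE z (by simpa using hz)
        _ = E / r ^ n * r ^ n := by field_simp
        _ ≤ E / r ^ n * ‖z‖ ^ n := by gcongr
        _ ≤ _ := by gcongr; exact le_max_right _ _
  have all : ∀ n : ℕ, ∃ M, 0 ≤ M ∧ ∀ z, ‖z‖ ≤ 2 → ‖w z‖ ≤ M * ‖z‖ ^ (n + 1) := by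
    intro n
    induction n with
    | zero =>
      have hO := ((hw.differentiable (by norm_num) 0).hasFDerivAt).isBigO_sub
      obtain ⟨M, hM⟩ := hO.bound
      obtain ⟨r, hr, hb⟩ := Metric.eventually_nhds_iff_ball.1 hM
      refine ext 1 M (r/2) (by positivity) (fun z hz => ?_)
      have := hb z (by rw [mem_ball_zero_iff]; linarith)
      simpa [hw0] using this
    | succ n ih =>
      obtain ⟨M, hM0, hM⟩ := ih
      obtain ⟨c, C', h⟩ := stepA w g hw hg hwg n M (C * M) hM (hgw (n+1) M 2 hM0 le_rfl hM)
      have hc : c = 0 := by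
        by_contra hc
        exact hex ⟨n, c, C', hc, h⟩
      refine ext (n+2) C' 1 one_pos (fun z hz => ?_)
      have := h z hz
      simpa [hc] using this
  obtain ⟨R, hR, hz⟩ := stepB w g hw hg hwg C hC0 (by
    intro n
    cases n with
    | zero =>
      obtain ⟨E, hE⟩ := (isCompact_closedBall (0:ℂ) 2).exists_bound_of_continuousOn hw.continuous.continuousOn
      exact ⟨E, fun z hz => by simpa using hE z (by simpa using hz)⟩
    | succ n => obtain ⟨M, _, h⟩ := all n; exact ⟨M, h⟩) hgw
  have h1 := mean_value u hud h0 0 0 (R/2) le_rfl (fun z hz' => by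
    rw [← hwdef, hz z (by linarith)]; simp)
  filter_upwards [Metric.closedBall_mem_nhds (0:ℂ) (half_pos hR)] with z hz'
  have := h1 z (by simpa using hz')
  simpa using this

/-- Real and imaginary parts of `(x + i y)^m`. -/
noncomputable def ReIm : ℕ → MvPolynomial (Fin 2) ℝ × MvPolynomial (Fin 2) ℝ
  | 0 => (1, 0)
  | m + 1 => (MvPolynomial.X 0 * (ReIm m).1 - MvPolynomial.X 1 * (ReIm m).2,
      MvPolynomial.X 1 * (ReIm m).1 + MvPolynomial.X 0 * (ReIm m).2)

lemma ReIm_hom (m : ℕ) : (ReIm m).1.IsHomogeneous m ∧ (ReIm m).2.IsHomogeneous m := by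
  induction m with
  | zero => exact ⟨MvPolynomial.isHomogeneous_one _ _, MvPolynomial.isHomogeneous_zero _ _ _⟩
  | succ m ih =>
    have hX : ∀ i : Fin 2, (MvPolynomial.X i : MvPolynomial (Fin 2) ℝ).IsHomogeneous 1 :=
      fun i => MvPolynomial.isHomogeneous_X _ _
    simp only [ReIm]
    rw [add_comm m 1]
    exact ⟨((hX 0).mul ih.1).sub ((hX 1).mul ih.2), ((hX 1).mul ih.1).add ((hX 0).mul ih.2)⟩

lemma ReIm_CR (m : ℕ) : MvPolynomial.pderiv 0 (ReIm m).1 = MvPolynomial.pderiv 1 (ReIm m).2 ∧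
    MvPolynomial.pderiv 1 (ReIm m).1 = - MvPolynomial.pderiv 0 (ReIm m).2 := by
  induction m with
  | zero => simp [ReIm]
  | succ m ih =>
    simp only [ReIm, map_add, map_sub, MvPolynomial.pderiv_mul, MvPolynomial.pderiv_X_self,
      MvPolynomial.pderiv_X_of_ne (show (1 : Fin 2) ≠ 0 by decide),
      MvPolynomial.pderiv_X_of_ne (show (0 : Fin 2) ≠ 1 by decide), ih.1, ih.2]
    constructor <;> ring

lemma pderiv_comm' (p : MvPolynomial (Fin 2) ℝ) :
    MvPolynomial.pderiv 0 (MvPolynomial.pderiv 1 p) = MvPolynomial.pderiv 1 (MvPolynomial.pderiv 0 p) := by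
  have : ⁅(MvPolynomial.pderiv 0 : Derivation ℝ (MvPolynomial (Fin 2) ℝ) (MvPolynomial (Fin 2) ℝ)),
      (MvPolynomial.pderiv 1 : Derivation ℝ (MvPolynomial (Fin 2) ℝ) (MvPolynomial (Fin 2) ℝ))⁆ = 0 := by
    apply MvPolynomial.derivation_ext
    intro i
    rw [Derivation.commutator_apply]
    fin_cases i <;> simp [MvPolynomial.pderiv_X, Pi.single_apply]
  have h := congrArg (fun D => D p) this
  simp only [Derivation.commutator_apply] at h
  exact sub_eq_zero.1 h

lemma ReIm_eval (m : ℕ) (f : Fin 2 → ℝ) :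
    ((f 0 : ℂ) + f 1 * I) ^ m = (MvPolynomial.eval f (ReIm m).1 : ℝ) + (MvPolynomial.eval f (ReIm m).2 : ℝ) * I := by
  induction m with
  | zero => simp [ReIm]
  | succ m ih =>
    rw [pow_succ, ih]
    simp only [ReIm, map_add, map_sub, map_mul, MvPolynomial.eval_X]
    push_cast
    linear_combination ((f 1 : ℂ) * (MvPolynomial.eval f (ReIm m).2 : ℝ)) * I_sq

lemma exists_Q (m : ℕ) (hm : m ≠ 0) (a : ℂ) (ha : a ≠ 0) : ∃ Q : MvPolynomial (Fin 2) ℝ, Q ≠ 0 ∧ Q.IsHomogeneous m ∧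
    MvPolynomial.pderiv 0 (MvPolynomial.pderiv 0 Q)
        + MvPolynomial.pderiv 1 (MvPolynomial.pderiv 1 Q) = 0 ∧
    ∀ f : Fin 2 → ℝ, MvPolynomial.eval f Q = (a * ((f 0 : ℂ) + f 1 * I) ^ m).re := by
  have hev : ∀ f : Fin 2 → ℝ, MvPolynomial.eval f (MvPolynomial.C a.re * (ReIm m).1 - MvPolynomial.C a.im * (ReIm m).2)
      = (a * ((f 0 : ℂ) + f 1 * I) ^ m).re := by
    intro f
    rw [ReIm_eval]
    simp
  refine ⟨MvPolynomial.C a.re * (ReIm m).1 - MvPolynomial.C a.im * (ReIm m).2, ?_, ?_, ?_, hev⟩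
  · intro h
    obtain ⟨z, hz⟩ := IsAlgClosed.exists_pow_nat_eq (starRingEnd ℂ a) (Nat.pos_of_ne_zero hm)
    have h1 := hev ![z.re, z.im]
    rw [h] at h1
    simp only [Matrix.cons_val_zero, Matrix.cons_val_one, Complex.re_add_im, hz, Complex.mul_conj, map_zero, Complex.ofReal_re] at h1
    exact ha (Complex.normSq_eq_zero.1 h1.symm)
  · have hC : ∀ r : ℝ, (MvPolynomial.C r : MvPolynomial (Fin 2) ℝ).IsHomogeneous 0 :=
      fun r => MvPolynomial.isHomogeneous_C _ _
    have h1 := (hC a.re).mul (ReIm_hom m).1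
    have h2 := (hC a.im).mul (ReIm_hom m).2
    rw [zero_add] at h1 h2
    exact h1.sub h2
  · obtain ⟨h1, h2⟩ := ReIm_CR m
    have h3 : MvPolynomial.pderiv 1 (ReIm m).2 = MvPolynomial.pderiv 0 (ReIm m).1 := h1.symm
    have h4 : MvPolynomial.pderiv 0 (ReIm m).2 = - MvPolynomial.pderiv 1 (ReIm m).1 := by rw [h2, neg_neg]
    have e1 : MvPolynomial.pderiv 0 (MvPolynomial.pderiv 0 (ReIm m).1) = MvPolynomial.pderiv 1 (MvPolynomial.pderiv 0 (ReIm m).2) := by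
      rw [h1, pderiv_comm']
    have e2 : MvPolynomial.pderiv 1 (MvPolynomial.pderiv 1 (ReIm m).1) = - MvPolynomial.pderiv 1 (MvPolynomial.pderiv 0 (ReIm m).2) := by
      rw [h2, map_neg]
    have e3 : MvPolynomial.pderiv 1 (MvPolynomial.pderiv 1 (ReIm m).2) = MvPolynomial.pderiv 1 (MvPolynomial.pderiv 0 (ReIm m).1) := by
      rw [h3]
    have e4 : MvPolynomial.pderiv 0 (MvPolynomial.pderiv 0 (ReIm m).2) = - MvPolynomial.pderiv 1 (MvPolynomial.pderiv 0 (ReIm m).1) := by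
      rw [h4, map_neg, pderiv_comm']
    simp only [map_sub, MvPolynomial.pderiv_C_mul, e1, e2, e3, e4]
    simp

/-- The standard isometry of `ℂ` with the Euclidean plane. -/
noncomputable def e : ℂ ≃ₗᵢ[ℝ] EuclideanSpace ℝ (Fin 2) := Complex.orthonormalBasisOneI.repr

lemma e_one : e 1 = EuclideanSpace.single 0 1 := by
  ext i; fin_cases i <;> simp [e]

lemma e_I : e I = EuclideanSpace.single 1 1 := by
  ext i; fin_cases i <;> simp [e]

lemma e_zero_coord (z : ℂ) : e z 0 = z.re := by simp [e]
lemma e_one_coord (z : ℂ) : e z 1 = z.im := by simp [e]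

lemma fderiv_shift (f : EuclideanSpace ℝ (Fin 2) → ℝ) (hf : Differentiable ℝ f)
    (p : EuclideanSpace ℝ (Fin 2)) (z v : ℂ) :
    fderiv ℝ (fun z => f (p + e z)) z v = fderiv ℝ f (p + e z) (e v) := by
  have h1 : HasFDerivAt (fun z => p + e z) (e.toContinuousLinearEquiv : ℂ →L[ℝ] EuclideanSpace ℝ (Fin 2)) z :=
    (e.toContinuousLinearEquiv : ℂ →L[ℝ] EuclideanSpace ℝ (Fin 2)).hasFDerivAt.const_add p
  have h2 := (hf (p + e z)).hasFDerivAt.comp z h1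
  have h3 : fderiv ℝ (fun z => f (p + e z)) z = _ := h2.fderiv
  rw [h3]; rfl

lemma local_plane (K φ : EuclideanSpace ℝ (Fin 2) → ℝ) (hK : Continuous K) (hφ : ContDiff ℝ 2 φ)
    (hpde : ∀ y : EuclideanSpace ℝ (Fin 2), planeLaplacian φ y + K y * φ y = 0)
    (p : EuclideanSpace ℝ (Fin 2)) (h0 : φ p = 0) (hg : fderiv ℝ φ p = 0) :
    (∀ᶠ z in 𝓝 (0:ℂ), φ (p + e z) = 0) ∨
    ∃ (n : ℕ) (c : ℂ) (C : ℝ), c ≠ 0 ∧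
      ∀ z, ‖z‖ ≤ 1 → ‖cgrad (fun z => φ (p + e z)) z - c * z ^ (n + 1)‖ ≤ C * ‖z‖ ^ (n + 2) := by
  have hec : ContDiff ℝ 2 (fun z => p + e z) := contDiff_const.add e.contDiff
  have hd : Differentiable ℝ φ := hφ.differentiable (by norm_num)
  have h1 : ContDiff ℝ 1 (fderiv ℝ φ) := hφ.fderiv_right (by norm_num)
  have hd2 : ∀ v, Differentiable ℝ (fun y => fderiv ℝ φ y v) := fun v =>
    (h1.clm_apply contDiff_const).differentiable (by norm_num)
  refine local_alt (fun z => φ (p + e z)) (fun z => K (p + e z)) (hφ.comp hec)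
    (hK.comp hec.continuous) ?_ (by simpa using h0) ?_
  · intro z
    have := hpde (p + e z)
    rw [planeLaplacian, Fin.sum_univ_two] at this
    simp only [fderiv_shift φ hd p]
    rw [fderiv_shift (fun y => fderiv ℝ φ y (e 1)) (hd2 _) p,
      fderiv_shift (fun y => fderiv ℝ φ y (e I)) (hd2 _) p, e_one, e_I]
    exact this
  · ext1
    rw [fderiv_shift φ hd p]
    simp [hg]

lemma e_tendsto (p : EuclideanSpace ℝ (Fin 2)) : Tendsto (fun y => e.symm (y - p)) (𝓝 p) (𝓝 0) := by
  have : Continuous (fun y => e.symm (y - p)) := by fun_prop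
  simpa using this.tendsto p

lemma unique_cont (K φ : EuclideanSpace ℝ (Fin 2) → ℝ) (hK : Continuous K) (hφ : ContDiff ℝ 2 φ)
    (hpde : ∀ y : EuclideanSpace ℝ (Fin 2), planeLaplacian φ y + K y * φ y = 0)
    (p : EuclideanSpace ℝ (Fin 2)) (hp : ∀ᶠ y in 𝓝 p, φ y = 0) : ∀ y, φ y = 0 := by
  have hd : Differentiable ℝ φ := hφ.differentiable (by norm_num)
  have h1 : Continuous (fderiv ℝ φ) := hφ.continuous_fderiv (by norm_num)
  let S : Set (EuclideanSpace ℝ (Fin 2)) := {q | ∀ᶠ y in 𝓝 q, φ y = 0}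
  have hSo : IsOpen S := isOpen_setOfPred_eventually_nhds
  have hSφ : ∀ q ∈ S, φ q = 0 := fun q hq => by
    have h : ∀ᶠ y in 𝓝 q, φ y = 0 := hq
    exact h.self_of_nhds
  have hSd : ∀ q ∈ S, fderiv ℝ φ q = 0 := fun q hq => by
    have : φ =ᶠ[𝓝 q] 0 := hq
    rw [this.fderiv_eq]; simp
  have hSc : IsClosed S := by
    rw [← closure_subset_iff_isClosed]
    intro q hq
    have c0 : φ q = 0 := by
      have : closure S ⊆ {y | φ y = 0} :=
        closure_minimal hSφ (isClosed_eq hφ.continuous continuous_const)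
      exact this hq
    have c1 : fderiv ℝ φ q = 0 := by
      have : closure S ⊆ {y | fderiv ℝ φ y = 0} :=
        closure_minimal hSd (isClosed_eq h1 continuous_const)
      exact this hq
    rcases local_plane K φ hK hφ hpde q c0 c1 with h | ⟨n, c, C, hc, h⟩
    · have := (e_tendsto q).eventually h
      have h' : ∀ᶠ y in 𝓝 q, φ y = 0 := by simpa using this
      exact h'
    · by_contra hqS
      -- the complex gradient has no zeros in a punctured neighbourhood of `q`
      have hne : ∀ᶠ z in 𝓝 (0:ℂ), z ≠ 0 → cgrad (fun z => φ (q + e z)) z ≠ 0 := by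
        have hcp : 0 < ‖c‖ := norm_pos_iff.2 hc
        have hlt : ∀ᶠ z in 𝓝 (0:ℂ), C * ‖z‖ < ‖c‖ := by
          have : Continuous (fun z : ℂ => C * ‖z‖) := by fun_prop
          exact (this.tendsto 0).eventually_lt_const (by simpa using hcp)
        filter_upwards [hlt, Metric.closedBall_mem_nhds (0:ℂ) one_pos] with z hz hz1 hz0 hzero
        have := h z (by simpa using hz1)
        rw [hzero, zero_sub, norm_neg, norm_mul, norm_pow] at this
        have hzp : 0 < ‖z‖ := norm_pos_iff.2 hz0
        have h3 : C * ‖z‖ ^ (n+2) = C * ‖z‖ * ‖z‖ ^ (n+1) := by ring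
        rw [h3] at this
        exact absurd (le_of_mul_le_mul_right this (by positivity)) (not_le.2 hz)
      have hev := (e_tendsto q).eventually hne
      obtain ⟨y, hyS, hy⟩ := (mem_closure_iff_frequently.1 hq).and_eventually hev |>.exists
      have hyq : y ≠ q := fun h => hqS (h ▸ hyS)
      refine hy (by simpa [sub_eq_zero] using hyq) ?_
      rw [cgrad, fderiv_shift φ hd, fderiv_shift φ hd]
      simp [hSd y hyS]
  have hS : S = univ := IsClopen.eq_univ ⟨hSc, hSo⟩ ⟨p, hp⟩
  intro y
  exact hSφ y (hS ▸ mem_univ y)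

end HW

/-- Local structure at a degenerate zero (Hartman–Wintner type expansion):
if `φ ≢ 0` is a `C²` solution of `Δφ + Kφ = 0` on `ℝ²` with smooth `K`, and
`φ(0) = 0`, `∇φ(0) = 0`, then there is an integer `m ≥ 2` and a nonzero
homogeneous harmonic polynomial `Q` of degree `m` with
`φ(y) = Q(y) + o(|y|^m)` as `y → 0`. -/
theorem local_structure_degenerate_zero
    (K : EuclideanSpace ℝ (Fin 2) → ℝ) (hK : ContDiff ℝ (⊤ : ℕ∞) K)
    (φ : EuclideanSpace ℝ (Fin 2) → ℝ) (hφ : ContDiff ℝ 2 φ)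
    (hne : ∃ y, φ y ≠ 0)
    (hpde : ∀ y : EuclideanSpace ℝ (Fin 2), planeLaplacian φ y + K y * φ y = 0)
    (h0 : φ 0 = 0) (hgrad : fderiv ℝ φ 0 = 0) :
    ∃ (m : ℕ) (Q : MvPolynomial (Fin 2) ℝ), 2 ≤ m ∧ Q ≠ 0 ∧
      Q.IsHomogeneous m ∧
      MvPolynomial.pderiv 0 (MvPolynomial.pderiv 0 Q)
        + MvPolynomial.pderiv 1 (MvPolynomial.pderiv 1 Q) = 0 ∧
      (fun y : EuclideanSpace ℝ (Fin 2) =>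
          φ y - MvPolynomial.eval (fun i => y i) Q)
        =o[nhds 0] (fun y : EuclideanSpace ℝ (Fin 2) => ‖y‖ ^ m) := by
  have hd : Differentiable ℝ φ := hφ.differentiable (by norm_num)
  rcases HW.local_plane K φ hK.continuous hφ hpde 0 h0 hgrad with h | ⟨n, c, C, hc, h⟩
  · exfalso
    obtain ⟨y, hy⟩ := hne
    refine hy (HW.unique_cont K φ hK.continuous hφ hpde 0 ?_ y)
    have := (HW.e_tendsto 0).eventually h
    simpa using this
  have hm : ((n + 2 : ℕ) : ℂ) ≠ 0 := by exact_mod_cast (Nat.succ_ne_zero (n+1))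
  obtain ⟨Q, hQ0, hQh, hQl, hQe⟩ := HW.exists_Q (n + 2) (by omega) (c / (n + 2 : ℕ)) (div_ne_zero hc hm)
  refine ⟨n + 2, Q, by omega, hQ0, hQh, hQl, ?_⟩
  set u : ℂ → ℝ := fun z => φ (0 + HW.e z) with hu
  have hud : Differentiable ℝ u := by
    have : Differentiable ℝ (fun z => (0 : EuclideanSpace ℝ (Fin 2)) + HW.e z) := by
      have := HW.e.differentiable
      fun_prop
    exact hd.comp this
  set q : ℂ → ℝ := fun z => (c / (n + 2 : ℕ) * z ^ (n + 2)).re with hq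
  have hqd : ∀ z, HasFDerivAt q (Complex.reCLM.comp
      ((ContinuousLinearMap.toSpanSingleton ℂ (c * z ^ (n+1))).restrictScalars ℝ)) z := by
    intro z
    have h1 : HasDerivAt (fun z : ℂ => c / (n + 2 : ℕ) * z ^ (n + 2)) (c * z ^ (n+1)) z := by
      refine ((hasDerivAt_pow (n+2) z).const_mul (c / (n + 2 : ℕ))).congr_deriv ?_
      rw [show n + 2 - 1 = n + 1 by omega]
      field_simp
    exact Complex.reCLM.hasFDerivAt.comp z (h1.hasFDerivAt.restrictScalars ℝ)
  have hcg : ∀ z, HW.cgrad (fun z => u z - q z) z = HW.cgrad u z - c * z ^ (n+1) := by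
    intro z
    have h1 := (hud z).hasFDerivAt.sub (hqd z)
    have h2 : fderiv ℝ (fun z => u z - q z) z = _ := h1.fderiv
    rw [HW.cgrad, h2, HW.cgrad]
    apply Complex.ext
    · simp
    · simp; ring
  have hC : 0 ≤ max C 0 := le_max_right _ _
  have hv := HW.mean_value (fun z => u z - q z) (fun z => (hud z).sub (hqd z).differentiableAt)
    (by simp [hu, hq, h0]) (n + 2) (max C 0) 1 hC (by
      intro z hz
      rw [hcg]
      exact (h z hz).trans (by gcongr; exact le_max_left _ _))
  have hO : (fun y : EuclideanSpace ℝ (Fin 2) => φ y - MvPolynomial.eval (fun i => y i) Q)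
      =O[nhds 0] (fun y : EuclideanSpace ℝ (Fin 2) => ‖y‖ ^ (n + 3)) := by
    refine IsBigO.of_bound (max C 0) ?_
    filter_upwards [Metric.closedBall_mem_nhds (0 : EuclideanSpace ℝ (Fin 2)) one_pos] with y hy
    rw [mem_closedBall_zero_iff] at hy
    have h1 := hv (HW.e.symm y) (by simpa using hy)
    have h2 : MvPolynomial.eval (fun i => y i) Q = q (HW.e.symm y) := by
      rw [hQe, hq]
      have a0 := HW.e_zero_coord (HW.e.symm y)
      have a1 := HW.e_one_coord (HW.e.symm y)
      rw [LinearIsometryEquiv.apply_symm_apply] at a0 a1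
      simp only [a0, a1, Complex.re_add_im]
    rw [h2, Real.norm_eq_abs, norm_pow, norm_norm]
    simpa [hu] using h1
  refine hO.trans_isLittleO ?_
  have h3 : (fun y : EuclideanSpace ℝ (Fin 2) => ‖y‖ ^ (n + 3)) =o[nhds 0] (fun y => ‖y‖ ^ (n + 2)) :=
    (isLittleO_pow_pow (𝕜 := ℝ) (show n + 2 < n + 3 by omega)).comp_tendsto
      (tendsto_norm_zero (E := EuclideanSpace ℝ (Fin 2)))
  exact h3
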